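/- Define J : (Fin 4 → ℝ) × (Fin 4 → ℝ) → ℝ by J(x,p) = (p 0)² − (p 1)² − (p 2)² − (p 3)². If f : (Fin 4 → ℝ) × (Fin 4 → ℝ) → ℝ is infinitely differentiable (ContDiff ℝ ⊤ f) and vanishes on the zero locus of J (i.e. f(x,p) = 0 whenever J(x,p) = 0), then there exists an infinitely differentiable h : (Fin 4 → ℝ) × (Fin 4 → ℝ) → ℝ with f = h · J. In other words, the ideal of smooth functions vanishing on the constraint set C(0) = {J = 0} coincides with the ideal generated by J in the algebra of smooth functions. (Lemma 5.2, due to Gotay.) -/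

import Mathlib

/-- The zero-rest-mass constraint function on the phase space of
four-dimensional Minkowski space: `J (x, p) = p₀² − p₁² − p₂² − p₃²`. -/
noncomputable def minkowskiMomentMap : (Fin 4 → ℝ) × (Fin 4 → ℝ) → ℝ :=
  fun z => (z.2 0) ^ 2 - (z.2 1) ^ 2 - (z.2 2) ^ 2 - (z.2 3) ^ 2

open Set Filter Topology

theorem gl_zero_of_off_finite {F : Type} [NormedAddCommGroup F]
    (g : ℝ → F) (hg : Continuous g) (S : Set ℝ) (hS : S.Finite) (h : ∀ r, r ∉ S → g r = 0) (r : ℝ) :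
    g r = 0 := by
  have hd : Dense Sᶜ := Set.Countable.dense_compl ℝ hS.countable
  have := Continuous.ext_on hd hg (continuous_const (y := (0:F))) (fun r hr => h r hr)
  exact congrFun this r

theorem gl_integral_contDiff_nat (n : ℕ) : ∀ {E F : Type} [NormedAddCommGroup E] [NormedSpace ℝ E]
    [FiniteDimensional ℝ E] [NormedAddCommGroup F] [NormedSpace ℝ F] [CompleteSpace F]
    (G : E × ℝ → F) (_ : ContDiff ℝ (⊤ : ℕ∞) G),
    ContDiff ℝ n (fun z => ∫ s in (0:ℝ)..1, G (z, s)) := by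
  induction n with
  | zero =>
    intro E F _ _ _ _ _ _ G hG
    have hc := hG.continuous
    exact contDiff_zero.2 (intervalIntegral.continuous_parametric_intervalIntegral_of_continuous'
      (f := fun z s => G (z, s)) (by simpa [Function.uncurry_def] using hc) 0 1)
  | succ n ih =>
    intro E F _ _ _ _ _ _ G hG
    let G' : E × ℝ → (E →L[ℝ] F) := fun w => (fderiv ℝ G w).comp (ContinuousLinearMap.inl ℝ E ℝ)
    have hG' : ContDiff ℝ (⊤ : ℕ∞) G' :=
      (hG.fderiv_right (m := (⊤ : ℕ∞)) (by simp)).clm_comp contDiff_const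
    have hc := hG.continuous
    have hc' := hG'.continuous
    push_cast
    rw [contDiff_succ_iff_hasFDerivAt]
    refine ⟨fun z => ∫ s in (0:ℝ)..1, G' (z, s), ih G' hG', fun z => ?_⟩
    have : ProperSpace E := FiniteDimensional.proper ℝ E
    obtain ⟨C, hC⟩ := ((isCompact_closedBall z 1).prod (isCompact_Icc (a := (0:ℝ)) (b := 1))).exists_bound_of_continuousOn
      hc'.continuousOn
    refine intervalIntegral.hasFDerivAt_integral_of_dominated_of_fderiv_le
      (F := fun z s => G (z, s)) (F' := fun z s => G' (z, s)) (bound := fun _ => C)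
      (Metric.closedBall_mem_nhds z one_pos) ?_ ?_ ?_ ?_ ?_ ?_
    · exact Eventually.of_forall fun x => (by fun_prop : Continuous fun s => G (x, s)).aestronglyMeasurable
    · exact (by fun_prop : Continuous fun s => G (z, s)).intervalIntegrable _ _
    · exact (by fun_prop : Continuous fun s => G' (z, s)).aestronglyMeasurable
    · refine Eventually.of_forall fun t ht x hx => hC (x, t) ⟨hx, ?_⟩
      rw [uIoc_of_le zero_le_one] at ht
      exact Ioc_subset_Icc_self ht
    · exact intervalIntegrable_const
    · refine Eventually.of_forall fun t ht x hx => ?_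
      have h1 : HasFDerivAt G (fderiv ℝ G (x, t)) (x, t) :=
        (hG.differentiable (by simp) (x, t)).hasFDerivAt
      exact h1.comp x (hasFDerivAt_prodMk_left x t)

theorem gl_integral_contDiff {E F : Type} [NormedAddCommGroup E] [NormedSpace ℝ E]
    [FiniteDimensional ℝ E] [NormedAddCommGroup F] [NormedSpace ℝ F] [CompleteSpace F]
    (G : E × ℝ → F) (hG : ContDiff ℝ (⊤ : ℕ∞) G) :
    ContDiff ℝ (⊤ : ℕ∞) (fun z => ∫ s in (0:ℝ)..1, G (z, s)) :=
  contDiff_infty.2 fun n => gl_integral_contDiff_nat n G hG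

theorem gl_hadamard {E F : Type} [NormedAddCommGroup E] [NormedSpace ℝ E]
    [FiniteDimensional ℝ E] [NormedAddCommGroup F] [NormedSpace ℝ F] [CompleteSpace F]
    (f : E × ℝ → F) (hf : ContDiff ℝ (⊤ : ℕ∞) f) (h0 : ∀ y, f (y, 0) = 0) :
    ∃ A : E × ℝ → F, ContDiff ℝ (⊤ : ℕ∞) A ∧ ∀ y t, f (y, t) = t • A (y, t) := by
  have hf' : ContDiff ℝ (⊤ : ℕ∞) (fderiv ℝ f) := hf.fderiv_right (m := (⊤ : ℕ∞)) (by simp)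
  refine ⟨fun w => ∫ s in (0:ℝ)..1, fderiv ℝ f (w.1, s * w.2) (0, 1), ?_, fun y t => ?_⟩
  · refine gl_integral_contDiff (fun v : (E × ℝ) × ℝ => fderiv ℝ f (v.1.1, v.2 * v.1.2) (0, 1)) ?_
    refine ContDiff.clm_apply (hf'.comp ?_) contDiff_const
    fun_prop
  · have hd : ∀ s ∈ uIcc (0:ℝ) 1, HasDerivAt (fun s => f (y, s * t))
        (t • fderiv ℝ f (y, s * t) (0, 1)) s := by
      intro s _
      have h1 : HasFDerivAt f (fderiv ℝ f (y, s * t)) (y, s * t) :=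
        (hf.differentiable (by simp) _).hasFDerivAt
      have h2 : HasDerivAt (fun s : ℝ => (y, s * t)) ((0 : E), t) s := by
        have h3 : HasDerivAt (fun s : ℝ => s * t) t s := by
          simpa using (hasDerivAt_id s).mul_const t
        exact (hasDerivAt_const s y).prodMk h3
      have h4 := h1.comp_hasDerivAt s h2
      rw [← map_smul]
      simpa [Function.comp_def] using h4
    have hc := hf'.continuous
    have := intervalIntegral.integral_eq_sub_of_hasDerivAt hd
      (Continuous.intervalIntegrable (by fun_prop) _ _)
    rw [intervalIntegral.integral_smul] at this
    simp [h0] at this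
    exact this.symm

theorem gl_norm_hasFDerivAt {P : Type} [NormedAddCommGroup P] [InnerProductSpace ℝ P] (p : P)
    (hp : p ≠ 0) : HasFDerivAt (fun p : P => ‖p‖) (‖p‖⁻¹ • innerSL ℝ p) p := by
  have h1 := (hasStrictFDerivAt_norm_sq p).hasFDerivAt
  have h2 := h1.sqrt (by simpa using hp)
  have h3 : (fun p : P => √(‖p‖ ^ 2)) = fun p => ‖p‖ := by
    funext q; simp
  rw [h3] at h2
  convert h2 using 1
  ext q
  simp
  field_simp

theorem gl_radial_nat {E P : Type} [NormedAddCommGroup E] [NormedSpace ℝ E] [FiniteDimensional ℝ E]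
    [NormedAddCommGroup P] [InnerProductSpace ℝ P] (n : ℕ) :
    ∀ {F : Type} [NormedAddCommGroup F] [NormedSpace ℝ F] [CompleteSpace F]
    (φ : E × ℝ → F) (_ : ContDiff ℝ (⊤ : ℕ∞) φ) (_ : ∀ z r, φ (z, -r) = φ (z, r)),
    ContDiff ℝ n (fun v : E × P => φ (v.1, ‖v.2‖)) := by
  induction n with
  | zero =>
    intro F _ _ _ φ hφ _
    have hc := hφ.continuous
    exact contDiff_zero.2 (by fun_prop)
  | succ n ih =>
    intro F _ _ _ φ hφ he
    have hD : ∀ w, HasFDerivAt φ (fderiv ℝ φ w) w := fun w =>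
      (hφ.differentiable (by simp) w).hasFDerivAt
    have hφ' : ContDiff ℝ (⊤ : ℕ∞) (fderiv ℝ φ) := hφ.fderiv_right (m := (⊤ : ℕ∞)) (by simp)
    have hsymm : ∀ z r (u : E) (c : ℝ), fderiv ℝ φ (z, -r) (u, -c) = fderiv ℝ φ (z, r) (u, c) := by
      intro z r u c
      let R : E × ℝ →L[ℝ] E × ℝ :=
        (ContinuousLinearMap.fst ℝ E ℝ).prod (-(ContinuousLinearMap.snd ℝ E ℝ))
      have h1 : HasFDerivAt (fun w => φ (R w)) ((fderiv ℝ φ (R (z, r))).comp R) (z, r) :=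
        (hD (R (z, r))).comp (z, r) R.hasFDerivAt
      have h2 : (fun w => φ (R w)) = φ := by
        funext w; exact he w.1 w.2
      rw [h2] at h1
      have h3 := h1.unique (hD (z, r))
      have h4 := congrArg (fun T => T (u, c)) h3
      simpa [R] using h4
    let φz : E × ℝ → (E →L[ℝ] F) := fun w => (fderiv ℝ φ w).comp (ContinuousLinearMap.inl ℝ E ℝ)
    have hφz : ContDiff ℝ (⊤ : ℕ∞) φz := hφ'.clm_comp contDiff_const
    have hφze : ∀ z r, φz (z, -r) = φz (z, r) := by
      intro z r
      ext u
      have := hsymm z r u 0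
      simpa [φz] using this
    have hr : ContDiff ℝ (⊤ : ℕ∞) (fun w => fderiv ℝ φ w (0, 1)) := hφ'.clm_apply contDiff_const
    have hodd : ∀ z r, fderiv ℝ φ (z, -r) (0, 1) = -fderiv ℝ φ (z, r) (0, 1) := by
      intro z r
      rw [← hsymm z r 0 1, ← map_neg]
      simp
    have hr0 : ∀ z, fderiv ℝ φ (z, 0) (0, 1) = 0 := by
      intro z
      have := hodd z 0
      rw [neg_zero] at this
      have h2 : (2 : ℝ) • fderiv ℝ φ (z, 0) (0, 1) = 0 := by
        rw [two_smul]
        exact add_eq_zero_iff_eq_neg.2 this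
      exact (smul_eq_zero.1 h2).resolve_left two_ne_zero
    obtain ⟨ψ, hψ, hψe⟩ := gl_hadamard _ hr hr0
    have hψev : ∀ z r, ψ (z, -r) = ψ (z, r) := by
      intro z r
      have hc := hψ.continuous
      have := gl_zero_of_off_finite (fun r => ψ (z, -r) - ψ (z, r)) (by fun_prop) {0}
        (finite_singleton 0) (fun r hr => ?_) r
      · exact sub_eq_zero.1 this
      · have hr : r ≠ 0 := by simpa using hr
        have h1 := hodd z r
        rw [hψe, hψe, neg_smul, neg_inj] at h1
        rw [sub_eq_zero]
        exact smul_right_injective F hr h1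
    push_cast
    rw [contDiff_succ_iff_hasFDerivAt]
    refine ⟨fun v => (φz (v.1, ‖v.2‖)).comp (ContinuousLinearMap.fst ℝ E P) +
      ((innerSL ℝ v.2).comp (ContinuousLinearMap.snd ℝ E P)).smulRight (ψ (v.1, ‖v.2‖)), ?_, ?_⟩
    · refine ContDiff.add ((ih φz hφz hφze).clm_comp contDiff_const) (ContDiff.smulRight ?_ (ih ψ hψ hψev))
      exact ContDiff.clm_comp ((innerSL ℝ).contDiff.comp contDiff_snd) contDiff_const
    · rintro ⟨z, p⟩
      by_cases hp : p = 0
      · subst hp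
        have h1 := hD (z, 0)
        have hL : ∀ u c, fderiv ℝ φ (z, 0) (u, c) = φz (z, 0) u := by
          intro u c
          have : ((u, c) : E × ℝ) = (u, 0) + c • (0, 1) := by simp
          rw [this, map_add, map_smul, hr0]
          simp [φz]
        rw [hasFDerivAt_iff_isLittleO_nhds_zero] at h1 ⊢
        have ht : Tendsto (fun v : E × P => (v.1, ‖v.2‖)) (𝓝 0) (𝓝 0) := by
          have : Continuous (fun v : E × P => (v.1, ‖v.2‖)) := by fun_prop
          simpa [← Prod.zero_eq_mk] using this.tendsto 0
        have h2 := h1.comp_tendsto ht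
        refine (h2.trans_isBigO (Asymptotics.isBigO_of_le _ fun v => ?_)).congr_left fun v => ?_
        · simp [Prod.norm_def]
        · simp [hL]
      · have h1 := hD (z, ‖p‖)
        have h2 : HasFDerivAt (fun v : E × P => ‖v.2‖)
            ((‖p‖⁻¹ • innerSL ℝ p).comp (ContinuousLinearMap.snd ℝ E P)) (z, p) :=
          (gl_norm_hasFDerivAt p hp).comp (z, p) (hasFDerivAt_snd (p := (z, p)))
        have h3 := h1.comp (z, p) ((hasFDerivAt_fst (p := (z, p))).prodMk h2)
        refine h3.congr_fderiv ?_
        ext u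
        · simp [φz]
        · have : ∀ c : ℝ, ((0 : E), c) = c • (0, 1) := by intro c; simp
          have hp' : ‖p‖ ≠ 0 := norm_ne_zero_iff.2 hp
          simp only [ContinuousLinearMap.comp_apply, ContinuousLinearMap.prod_apply,
            ContinuousLinearMap.inr_apply, ContinuousLinearMap.coe_fst',
            ContinuousLinearMap.coe_snd', _root_.smul_apply,
            _root_.add_apply, ContinuousLinearMap.smulRight_apply, map_zero, zero_add]
          rw [this, map_smul, hψe, smul_smul]
          congr 1
          simp
          field_simp

theorem gl_radial {E P F : Type} [NormedAddCommGroup E] [NormedSpace ℝ E] [FiniteDimensional ℝ E]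
    [NormedAddCommGroup P] [InnerProductSpace ℝ P]
    [NormedAddCommGroup F] [NormedSpace ℝ F] [CompleteSpace F]
    (φ : E × ℝ → F) (hφ : ContDiff ℝ (⊤ : ℕ∞) φ) (he : ∀ z r, φ (z, -r) = φ (z, r)) :
    ContDiff ℝ (⊤ : ℕ∞) (fun v : E × P => φ (v.1, ‖v.2‖)) :=
  contDiff_infty.2 fun n => gl_radial_nat n φ hφ he

theorem gl_even {E P : Type} [NormedAddCommGroup E] [NormedSpace ℝ E] [FiniteDimensional ℝ E]
    [NormedAddCommGroup P] [InnerProductSpace ℝ P] [FiniteDimensional ℝ P]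
    (f : (E × P) × ℝ → ℝ) (hf : ContDiff ℝ (⊤ : ℕ∞) f) (he : ∀ y t, f (y, -t) = f (y, t))
    (hv : ∀ x p, f ((x, p), ‖p‖) = 0) :
    ∃ h : (E × P) × ℝ → ℝ, ContDiff ℝ (⊤ : ℕ∞) h ∧
      ∀ x p t, f ((x, p), t) = h ((x, p), t) * (t ^ 2 - ‖p‖ ^ 2) := by
  obtain ⟨A, hA, hAe⟩ := gl_hadamard
    (fun w : ((E × P) × ℝ) × ℝ => f (w.1.1, w.1.2 + w.2) - f (w.1.1, w.1.2)) (by fun_prop) (by simp)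
  simp only [smul_eq_mul] at hAe
  obtain ⟨Q, hQ, hQe⟩ := gl_hadamard
    (fun w : ((E × P) × ℝ) × ℝ => A (w.1, w.2 - 2 * w.1.2)) (by fun_prop) (by
      rintro ⟨y, r⟩
      have hc := hA.continuous
      refine gl_zero_of_off_finite (fun r => A ((y, r), 0 - 2 * r)) (by fun_prop) {0}
        (finite_singleton 0) (fun r hr => ?_) r
      have hr : r ≠ 0 := by simpa using hr
      have h1 := hAe (y, r) (0 - 2 * r)
      have h2 : r + (0 - 2 * r) = -r := by ring
      simp only [h2, he, sub_self] at h1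
      rcases mul_eq_zero.1 h1.symm with h | h
      · exact absurd h (by simpa using hr)
      · exact h)
  simp only [smul_eq_mul] at hQe
  have key : ∀ y t r, f (y, t) - f (y, r) = (t ^ 2 - r ^ 2) * Q ((y, r), t + r) := by
    intro y t r
    have h1 := hAe (y, r) (t - r)
    have h2 := hQe (y, r) (t + r)
    have h3 : t + r - 2 * r = t - r := by ring
    simp only [h3] at h2
    simp only [add_sub_cancel] at h1
    rw [h1, h2]; ring
  let φ : ((E × P) × ℝ) × ℝ → ℝ := fun w => Q ((w.1.1, w.2), w.1.2 + w.2)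
  have hφ : ContDiff ℝ (⊤ : ℕ∞) φ := by fun_prop
  have hφe : ∀ z r, φ (z, -r) = φ (z, r) := by
    rintro ⟨y, t⟩ r
    have hc := hφ.continuous
    refine sub_eq_zero.1 (gl_zero_of_off_finite (fun r => φ ((y, t), -r) - φ ((y, t), r))
      (by fun_prop) {t, -t} (by simp) (fun r hr => ?_) r)
    have h1 := key y t r
    have h2 := key y t (-r)
    rw [he, h1, neg_sq] at h2
    have h3 : t ^ 2 - r ^ 2 ≠ 0 := by
      intro h
      apply hr
      have : (r - t) * (r + t) = 0 := by linarith
      rcases mul_eq_zero.1 this with h | h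
      · left; linarith
      · right; simp; linarith
    exact sub_eq_zero.2 (mul_left_cancel₀ h3 h2).symm
  refine ⟨fun w => φ (w, ‖w.1.2‖), ?_, fun x p t => ?_⟩
  · exact (gl_radial (P := P) φ hφ hφe).comp
      (contDiff_id.prodMk (contDiff_snd.comp contDiff_fst) :
        ContDiff ℝ (⊤ : ℕ∞) fun w : (E × P) × ℝ => (w, w.1.2))
  · have := key (x, p) t ‖p‖
    rw [hv, sub_zero] at this
    rw [this, mul_comm]

theorem gl_main {E P : Type} [NormedAddCommGroup E] [NormedSpace ℝ E] [FiniteDimensional ℝ E]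
    [NormedAddCommGroup P] [InnerProductSpace ℝ P] [FiniteDimensional ℝ P] [Nontrivial P]
    (f : (E × P) × ℝ → ℝ) (hf : ContDiff ℝ (⊤ : ℕ∞) f)
    (hv : ∀ x p t, t ^ 2 = ‖p‖ ^ 2 → f ((x, p), t) = 0) :
    ∃ h : (E × P) × ℝ → ℝ, ContDiff ℝ (⊤ : ℕ∞) h ∧
      ∀ x p t, f ((x, p), t) = h ((x, p), t) * (t ^ 2 - ‖p‖ ^ 2) := by
  obtain ⟨h1, hh1, e1⟩ := gl_even (fun w : (E × P) × ℝ => f (w.1, w.2) + f (w.1, -w.2))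
    (by fun_prop) (by intro y t; simp [add_comm])
    (by intro x p; simp [hv])
  obtain ⟨k, hk, ek⟩ := gl_hadamard (fun w : (E × P) × ℝ => f (w.1, w.2) - f (w.1, -w.2))
    (by fun_prop) (by simp)
  simp only [smul_eq_mul] at ek
  have hc := hk.continuous
  obtain ⟨h2, hh2, e2⟩ := gl_even k hk
    (by
      intro y t
      refine sub_eq_zero.1 (gl_zero_of_off_finite (fun r => k (y, -r) - k (y, r))
        (by fun_prop) {0} (finite_singleton 0) (fun r hr => ?_) t)
      have hr : r ≠ 0 := by simpa using hr
      have a := ek y r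
      have b := ek y (-r)
      simp only [neg_neg] at b
      have : r * (k (y, -r) - k (y, r)) = 0 := by linarith
      exact (mul_eq_zero.1 this).resolve_left hr)
    (by
      have hne : ∀ x (p : P), p ≠ 0 → k ((x, p), ‖p‖) = 0 := by
        intro x p hp
        have a := ek (x, p) ‖p‖
        simp only [hv x p ‖p‖ rfl, hv x p (-‖p‖) (by simp), sub_self] at a
        exact (mul_eq_zero.1 a.symm).resolve_left (norm_ne_zero_iff.2 hp)
      intro x p
      by_cases hp : p = 0
      · subst hp
        obtain ⟨q, hq⟩ := exists_ne (0 : P)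
        have := gl_zero_of_off_finite (fun s : ℝ => k ((x, s • q), ‖s • q‖)) (by fun_prop) {0}
          (finite_singleton 0) (fun r hr => hne _ _ (smul_ne_zero (by simpa using hr) hq)) 0
        simpa using this
      · exact hne x p hp)
  refine ⟨fun w => (h1 w + w.2 * h2 w) / 2, by fun_prop, fun x p t => ?_⟩
  have a := e1 x p t
  have b := ek (x, p) t
  have c := e2 x p t
  simp only at a b
  rw [c] at b
  linear_combination a / 2 + b / 2


theorem gotay_lemma
    (f : (Fin 4 → ℝ) × (Fin 4 → ℝ) → ℝ)
    (hf : ContDiff ℝ (⊤ : ℕ∞) f)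
    (hvan : ∀ z : (Fin 4 → ℝ) × (Fin 4 → ℝ), minkowskiMomentMap z = 0 → f z = 0) :
    ∃ h : (Fin 4 → ℝ) × (Fin 4 → ℝ) → ℝ,
      ContDiff ℝ (⊤ : ℕ∞) h ∧ f = fun z => h z * minkowskiMomentMap z := by
  have hn : ∀ p : EuclideanSpace ℝ (Fin 3), ‖p‖ ^ 2 = p 0 ^ 2 + p 1 ^ 2 + p 2 ^ 2 := by
    intro p
    simp [EuclideanSpace.norm_sq_eq, Fin.sum_univ_three]
  have hg : ContDiff ℝ (⊤ : ℕ∞)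
      (fun w : ((Fin 4 → ℝ) × EuclideanSpace ℝ (Fin 3)) × ℝ =>
        (w.1.1, (![w.2, w.1.2 0, w.1.2 1, w.1.2 2] : Fin 4 → ℝ))) := by
    refine (contDiff_fst.comp contDiff_fst).prodMk (contDiff_pi.2 fun i => ?_)
    fin_cases i <;> simp <;> fun_prop
  obtain ⟨h, hh, e⟩ := gl_main _ (hf.comp hg) (by
    intro x p t ht
    apply hvan
    rw [hn] at ht
    simp [minkowskiMomentMap]
    linarith)
  refine ⟨fun z => h ((z.1, WithLp.toLp 2 ![z.2 1, z.2 2, z.2 3]), z.2 0), hh.comp ?_, ?_⟩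
  · refine ContDiff.prodMk (contDiff_fst.prodMk ?_) (by fun_prop)
    refine (contDiff_euclidean).2 fun i => ?_
    fin_cases i <;> simp <;> fun_prop
  · funext ⟨x, p⟩
    have := e x (WithLp.toLp 2 ![p 1, p 2, p 3]) (p 0)
    have hp : (![p 0, p 1, p 2, p 3] : Fin 4 → ℝ) = p := by
      funext i; fin_cases i <;> rfl
    rw [hn] at this
    simp [hp] at this
    rw [this]
    simp [minkowskiMomentMap]
    left; ring
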